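/- Suppose F_2 is the exponential distribution with constant hazard rate α_2 > 0 (so F_2(z) = 1 − e^{−α_2 z}), g_2 is nondecreasing and concave, and c_2 is convex. Let y_2 ∈ B be the unique fixed point of Φ_2. Then for every (a,b,c) ∈ D the maximum of r ↦ φ_{2,y_2}(a,b,c,r) over [0,c] is attained at r*(a,b,c) = min( c, inf{ z ≥ 0 : α_2 Δ_2(a) ≤ c_2'(b+z) } ) (with inf ∅ = +∞); consequently y_2(a,b,c) = φ_{2,y_2}(a,b,c, r*(a,b,c)). -/

import Mathlib

open MeasureTheory Set Filter Topology
open scoped Classical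

noncomputable section

/-- The domain `D = {(a,b,c) ∈ [0,∞) × [0,t₀] × [0,t₀] : b + c ≤ t₀}`. -/
def Dset (t0 : ℝ) : Set (ℝ × ℝ × ℝ) :=
  {p | 0 ≤ p.1 ∧ p.2.1 ∈ Icc (0 : ℝ) t0 ∧ p.2.2 ∈ Icc (0 : ℝ) t0 ∧ p.2.1 + p.2.2 ≤ t0}

/-- Extension (by `0`) of a bounded continuous function on `D` to all of `ℝ³`. -/
def extD {t0 : ℝ} (δ : BoundedContinuousFunction (Dset t0) ℝ) : ℝ × ℝ × ℝ → ℝ :=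
  fun p => if h : p ∈ Dset t0 then δ ⟨p, h⟩ else 0

/-- `Δ₂(a) = E[g₂(a + X₂) - g₂(a)]`, where `ν` is the law of the fish weight `X₂`. -/
def DeltaFn (g : ℝ → ℝ) (ν : Measure ℝ) (a : ℝ) : ℝ := ∫ x, (g (a + x) - g a) ∂ν

/-- `φ_{2,δ}` in the exponential case with constant hazard rate `α₂`:
`φ_{2,δ}(a,b,c,r) = ∫_0^r e^{-α₂ z} { α₂[Δ₂(a) + ∫ δ(a+x,b+z,c-z) dH₂(x)] - c₂'(b+z) } dz`. -/
def phiExp (α2 : ℝ) (g2 c2 : ℝ → ℝ) (ν : Measure ℝ) (δ : ℝ × ℝ × ℝ → ℝ)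
    (a b c r : ℝ) : ℝ :=
  ∫ z in Ioc (0 : ℝ) r,
    Real.exp (-α2 * z) * (α2 * (DeltaFn g2 ν a + ∫ x, δ (a + x, b + z, c - z) ∂ν)
      - deriv c2 (b + z))

/-- The one-step-look-ahead threshold
`r*(a,b,c) = min( c, inf { z ≥ 0 : α₂ Δ₂(a) ≤ c₂'(b+z) } )` (with `inf ∅ = +∞`),
rendered as the infimum of the set together with `c`. -/
def rStarExp (α2 : ℝ) (g2 c2 : ℝ → ℝ) (ν : Measure ℝ) (a b c : ℝ) : ℝ :=
  sInf ({z | 0 ≤ z ∧ α2 * DeltaFn g2 ν a ≤ deriv c2 (b + z)} ∪ {c})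

theorem aux_measurable_extD {t0 : ℝ} (δ : BoundedContinuousFunction (Dset t0) ℝ) :
    Measurable (extD δ) := by
  have hD : MeasurableSet (Dset t0) := by
    apply IsClosed.measurableSet
    have : Dset t0 = {p : ℝ × ℝ × ℝ | 0 ≤ p.1} ∩ ({p | 0 ≤ p.2.1} ∩ ({p | p.2.1 ≤ t0} ∩
        ({p | 0 ≤ p.2.2} ∩ ({p | p.2.2 ≤ t0} ∩ {p | p.2.1 + p.2.2 ≤ t0})))) := by
      ext p
      simp only [Dset, Set.mem_ofPred_eq, Set.mem_inter_iff, Set.mem_Icc]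
      tauto
    rw [this]
    refine IsClosed.inter ?_ (IsClosed.inter ?_ (IsClosed.inter ?_ (IsClosed.inter ?_
      (IsClosed.inter ?_ ?_)))) <;> apply isClosed_le <;> fun_prop
  unfold extD
  exact Measurable.dite (s := Dset t0) (f := fun p => δ p) (g := fun _ => 0)
    δ.continuous.measurable measurable_const hD

theorem aux_abs_extD {t0 : ℝ} (δ : BoundedContinuousFunction (Dset t0) ℝ) (p) :
    |extD δ p| ≤ ‖δ‖ := by
  unfold extD
  split_ifs with h
  · exact δ.norm_coe_le_norm _
  · simp

theorem aux_ae_nonneg (ν : Measure ℝ) (hν : ν (Iio 0) = 0) : ∀ᵐ x ∂ν, 0 ≤ x := by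
  rw [ae_iff]
  convert hν using 2
  ext x
  simp

theorem aux_concave (g : ℝ → ℝ) (hg : ConcaveOn ℝ (Ici 0) g) {a a' x : ℝ} (ha : 0 ≤ a)
    (haa : a ≤ a') (hx : 0 ≤ x) : g (a' + x) - g a' ≤ g (a + x) - g a := by
  rcases eq_or_lt_of_le hx with rfl | hx
  · simp
  have hd : 0 < (a' - a) + x := by linarith
  have h1 := hg.2 (mem_Ici.2 ha) (show a' + x ∈ Ici 0 from mem_Ici.2 (by linarith))
    (show 0 ≤ x / ((a' - a) + x) by positivity)
    (show 0 ≤ (a' - a) / ((a' - a) + x) from div_nonneg (by linarith) hd.le) (by field_simp; ring)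
  have h2 := hg.2 (mem_Ici.2 ha) (show a' + x ∈ Ici 0 from mem_Ici.2 (by linarith))
    (show 0 ≤ (a' - a) / ((a' - a) + x) from div_nonneg (by linarith) hd.le)
    (show 0 ≤ x / ((a' - a) + x) by positivity) (by field_simp)
  simp only [smul_eq_mul] at h1 h2
  have e1 : x / ((a' - a) + x) * a + (a' - a) / ((a' - a) + x) * (a' + x) = a' := by
    field_simp; ring
  have e2 : (a' - a) / ((a' - a) + x) * a + x / ((a' - a) + x) * (a' + x) = a + x := by
    field_simp; ring
  rw [e1] at h1
  rw [e2] at h2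
  have e3 : x / ((a' - a) + x) = 1 - (a' - a) / ((a' - a) + x) := by field_simp; ring
  rw [e3] at h1 h2
  nlinarith

theorem aux_delta_integrable (G2 : ℝ) (ν : Measure ℝ) [IsProbabilityMeasure ν]
    (hν : ν (Iio 0) = 0) (g2 : ℝ → ℝ) (hg2c : Continuous g2)
    (hg2b : ∀ x ∈ Ici (0 : ℝ), g2 x ∈ Icc 0 G2) {a : ℝ} (ha : 0 ≤ a) :
    Integrable (fun x => g2 (a + x) - g2 a) ν := by
  refine Integrable.of_bound (C := G2) (by fun_prop) ?_
  filter_upwards [aux_ae_nonneg ν hν] with x hx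
  have h1 := hg2b (a + x) (mem_Ici.2 (by linarith))
  have h2 := hg2b a ha
  rw [Real.norm_eq_abs, abs_le]
  constructor <;> linarith [h1.1, h1.2, h2.1, h2.2]

theorem aux_delta_anti (G2 : ℝ) (ν : Measure ℝ) [IsProbabilityMeasure ν]
    (hν : ν (Iio 0) = 0) (g2 : ℝ → ℝ) (hg2c : Continuous g2)
    (hg2b : ∀ x ∈ Ici (0 : ℝ), g2 x ∈ Icc 0 G2)
    (hg2conc : ConcaveOn ℝ (Ici 0) g2) {a a' : ℝ} (ha : 0 ≤ a) (haa : a ≤ a') :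
    DeltaFn g2 ν a' ≤ DeltaFn g2 ν a := by
  unfold DeltaFn
  refine integral_mono_ae (aux_delta_integrable G2 ν hν g2 hg2c hg2b (ha.trans haa))
    (aux_delta_integrable G2 ν hν g2 hg2c hg2b ha) ?_
  filter_upwards [aux_ae_nonneg ν hν] with x hx
  exact aux_concave g2 hg2conc ha haa hx

theorem aux_deriv_mono (t0 : ℝ) (c2 : ℝ → ℝ) (hc2d : Differentiable ℝ c2)
    (hc2conv : ConvexOn ℝ (Icc 0 t0) c2) : MonotoneOn (deriv c2) (Icc 0 t0) :=
  hc2conv.monotoneOn_deriv (fun x _ => hc2d x)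

theorem aux_integrable (t0 α2 : ℝ) (hα2 : 0 < α2)
    (ν : Measure ℝ) [IsProbabilityMeasure ν] (g2 c2 : ℝ → ℝ)
    (hc2d : Differentiable ℝ c2) (hc2conv : ConvexOn ℝ (Icc 0 t0) c2)
    (y : BoundedContinuousFunction (Dset t0) ℝ) {a b c : ℝ} (hp : (a, b, c) ∈ Dset t0) :
    IntegrableOn (fun z => Real.exp (-α2 * z) * (α2 * (DeltaFn g2 ν a +
      ∫ x, extD y (a + x, b + z, c - z) ∂ν) - deriv c2 (b + z))) (Ioc 0 c) := by
  obtain ⟨h1, ⟨h2, h2'⟩, ⟨h3, h3'⟩, h4⟩ := hp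
  simp only at h1 h2 h2' h3 h3' h4
  have hI : Measurable (fun z => ∫ x, extD y (a + x, b + z, c - z) ∂ν) := by
    have : StronglyMeasurable (fun q : ℝ × ℝ => extD y (a + q.2, b + q.1, c - q.1)) :=
      ((aux_measurable_extD y).comp (by fun_prop)).stronglyMeasurable
    exact (this.integral_prod_right (ν := ν)).measurable
  have hm := measurable_deriv c2
  have hd := aux_deriv_mono t0 c2 hc2d hc2conv
  refine IntegrableOn.of_bound (C := α2 * (|DeltaFn g2 ν a| + ‖y‖) +
    (|deriv c2 0| + |deriv c2 t0|)) (by simp) ?_ ?_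
  · apply Measurable.aestronglyMeasurable
    have hm' : Measurable (fun z => deriv c2 (b + z)) := hm.comp (by fun_prop)
    fun_prop
  · refine (ae_restrict_mem measurableSet_Ioc).mono fun z hz => ?_
    have e1 : |Real.exp (-α2 * z)| ≤ 1 := by
      rw [abs_of_pos (Real.exp_pos _), Real.exp_le_one_iff]
      nlinarith [hz.1]
    have e2 : |∫ x, extD y (a + x, b + z, c - z) ∂ν| ≤ ‖y‖ := by
      have := norm_integral_le_of_norm_le_const (μ := ν) (C := ‖y‖)
        (f := fun x => extD y (a + x, b + z, c - z))
        (Eventually.of_forall fun x => aux_abs_extD y _)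
      simpa using this
    have hbz : b + z ∈ Icc 0 t0 := ⟨by linarith [hz.1], by linarith [hz.2]⟩
    have ht : 0 ≤ t0 := by linarith
    have e3 : |deriv c2 (b + z)| ≤ |deriv c2 0| + |deriv c2 t0| := by
      have u1 := hd (left_mem_Icc.2 ht) hbz hbz.1
      have u2 := hd hbz (right_mem_Icc.2 ht) hbz.2
      rw [abs_le]
      constructor
      · linarith [neg_abs_le (deriv c2 0), abs_nonneg (deriv c2 t0)]
      · linarith [le_abs_self (deriv c2 t0), abs_nonneg (deriv c2 0)]
    rw [Real.norm_eq_abs, abs_mul]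
    have e4 : |α2 * (DeltaFn g2 ν a + ∫ x, extD y (a + x, b + z, c - z) ∂ν)
        - deriv c2 (b + z)| ≤ α2 * (|DeltaFn g2 ν a| + ‖y‖) +
    (|deriv c2 0| + |deriv c2 t0|) := by
      refine (abs_sub _ _).trans (add_le_add ?_ e3)
      rw [abs_mul, abs_of_pos hα2]
      exact mul_le_mul_of_nonneg_left ((abs_add_le _ _).trans (by linarith)) hα2.le
    calc _ ≤ 1 * _ := mul_le_mul e1 e4 (abs_nonneg _) zero_le_one
      _ = _ := one_mul _

theorem aux_exp_integral (α r M : ℝ) (hr : 0 ≤ r) :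
    ∫ z in Ioc (0 : ℝ) r, Real.exp (-α * z) * (α * M) = (1 - Real.exp (-α * r)) * M := by
  rw [← intervalIntegral.integral_of_le hr]
  have := intervalIntegral.integral_eq_sub_of_hasDerivAt (a := 0) (b := r)
    (f := fun z => - Real.exp (-α * z) * M) (f' := fun z => Real.exp (-α * z) * (α * M)) ?_ ?_
  · rw [this]; simp; ring
  · intro z _
    have h : HasDerivAt (fun z : ℝ => -α * z) (-α) z := by
      simpa using (hasDerivAt_id z).const_mul (-α)
    have h2 := h.exp.neg.mul_const M
    have e : Real.exp (-α * z) * (α * M) = -(Real.exp (-α * z) * -α) * M := by ring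
    rw [e]
    exact h2
  · apply Continuous.intervalIntegrable
    fun_prop

theorem aux_split (f : ℝ → ℝ) {r s c : ℝ} (hr : 0 ≤ r) (hrs : r ≤ s) (hs : s ≤ c)
    (hf : IntegrableOn f (Ioc 0 c)) :
    ∫ z in Ioc 0 s, f z = (∫ z in Ioc 0 r, f z) + ∫ z in Ioo r s, f z := by
  rw [← integral_Ioc_eq_integral_Ioo, ← Ioc_union_Ioc_eq_Ioc hr hrs]
  refine setIntegral_union ?_ measurableSet_Ioc (hf.mono_set ?_) (hf.mono_set ?_)
  · exact Ioc_disjoint_Ioc_of_le le_rfl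
  · exact Ioc_subset_Ioc_right (hrs.trans hs)
  · exact Ioc_subset_Ioc hr hs

/-- **Explicit maximizer in the exponential / concave case**: if the inter-arrival
distribution is exponential with rate `α₂`, `g₂` is nondecreasing and concave and `c₂`
is convex, then for the unique fixed point `y₂` of `Φ₂` the maximum of
`r ↦ φ_{2,y₂}(a,b,c,r)` over `[0,c]` is attained at
`r*(a,b,c) = min(c, inf {z ≥ 0 : α₂ Δ₂(a) ≤ c₂'(b+z)})`, so that
`y₂(a,b,c) = φ_{2,y₂}(a,b,c,r*(a,b,c))`. -/
theorem phiExp_maximizer_concave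
    (t0 G2 C2 α2 : ℝ) (ht0 : 0 < t0) (hα2 : 0 < α2)
    (ν : Measure ℝ) [IsProbabilityMeasure ν] (hν : ν (Iio 0) = 0)
    (g2 c2 : ℝ → ℝ) (hg2c : Continuous g2)
    (hg2b : ∀ x ∈ Ici (0 : ℝ), g2 x ∈ Icc 0 G2)
    (hg2mono : MonotoneOn g2 (Ici 0)) (hg2conc : ConcaveOn ℝ (Ici 0) g2)
    (hc2c : Continuous c2) (hc2d : Differentiable ℝ c2)
    (hc2b : ∀ t ∈ Icc (0 : ℝ) t0, c2 t ∈ Icc 0 C2)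
    (hc2conv : ConvexOn ℝ (Icc 0 t0) c2)
    (Phi : BoundedContinuousFunction (Dset t0) ℝ → BoundedContinuousFunction (Dset t0) ℝ)
    (hPhi : ∀ (δ : BoundedContinuousFunction (Dset t0) ℝ) (q : Dset t0),
      Phi δ q = sSup ((fun r => phiExp α2 g2 c2 ν (extD δ)
        (q : ℝ × ℝ × ℝ).1 (q : ℝ × ℝ × ℝ).2.1 (q : ℝ × ℝ × ℝ).2.2 r) ''
        Icc 0 (q : ℝ × ℝ × ℝ).2.2))
    (y2 : BoundedContinuousFunction (Dset t0) ℝ) (hy2 : Phi y2 = y2)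
    (hy2unique : ∀ y : BoundedContinuousFunction (Dset t0) ℝ, Phi y = y → y = y2) :
    ∀ p : ℝ × ℝ × ℝ, ∀ hp : p ∈ Dset t0,
      IsGreatest
        ((fun r => phiExp α2 g2 c2 ν (extD y2) p.1 p.2.1 p.2.2 r) '' Icc 0 p.2.2)
        (phiExp α2 g2 c2 ν (extD y2) p.1 p.2.1 p.2.2
          (rStarExp α2 g2 c2 ν p.1 p.2.1 p.2.2)) ∧
      y2 ⟨p, hp⟩ = phiExp α2 g2 c2 ν (extD y2) p.1 p.2.1 p.2.2
          (rStarExp α2 g2 c2 ν p.1 p.2.1 p.2.2) := by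
  have hdm := aux_deriv_mono t0 c2 hc2d hc2conv
  have hfix : ∀ q : Dset t0, y2 q = sSup ((fun r => phiExp α2 g2 c2 ν (extD y2)
        (q : ℝ × ℝ × ℝ).1 (q : ℝ × ℝ × ℝ).2.1 (q : ℝ × ℝ × ℝ).2.2 r) ''
        Icc 0 (q : ℝ × ℝ × ℝ).2.2) := by
    intro q
    rw [← hPhi, hy2]
  have hy0 : ∀ q : Dset t0, 0 ≤ y2 q := by
    intro q
    rw [hfix q]
    by_cases hb : BddAbove ((fun r => phiExp α2 g2 c2 ν (extD y2)
        (q : ℝ × ℝ × ℝ).1 (q : ℝ × ℝ × ℝ).2.1 (q : ℝ × ℝ × ℝ).2.2 r) ''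
        Icc 0 (q : ℝ × ℝ × ℝ).2.2)
    · exact le_csSup hb ⟨0, ⟨le_rfl, q.2.2.2.1.1⟩, by simp [phiExp]⟩
    · rw [Real.sSup_of_not_bddAbove hb]
  have hext0 : ∀ p, 0 ≤ extD y2 p := by
    intro p
    unfold extD
    split_ifs
    · exact hy0 _
    · exact le_rfl
  set k := 1 - Real.exp (-α2 * t0) with hk
  have hk0 : 0 ≤ k := by
    rw [hk, sub_nonneg, Real.exp_le_one_iff]; nlinarith
  have hk1 : k < 1 := by
    rw [hk]; linarith [Real.exp_pos (-α2 * t0)]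
  have hstep : ∀ M : ℝ, 0 ≤ M →
      (∀ q : Dset t0, α2 * DeltaFn g2 ν q.1.1 ≤ deriv c2 q.1.2.1 → y2 q ≤ M) →
      (∀ q : Dset t0, α2 * DeltaFn g2 ν q.1.1 ≤ deriv c2 q.1.2.1 → y2 q ≤ k * M) := by
    rintro M hM hS ⟨⟨a, b, c⟩, hp⟩ hq
    simp only at hq
    have hp' := hp
    obtain ⟨h1, ⟨h2, h2'⟩, ⟨h3, h3'⟩, h4⟩ := hp'
    simp only at h1 h2 h2' h3 h3' h4
    rw [hfix]
    refine csSup_le ⟨_, 0, ⟨le_rfl, h3⟩, rfl⟩ ?_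
    rintro _ ⟨r, ⟨hr0, hrc⟩, rfl⟩
    simp only at hrc
    have hint := aux_integrable t0 α2 hα2 ν g2 c2 hc2d hc2conv y2 hp
    have : phiExp α2 g2 c2 ν (extD y2) a b c r ≤
        ∫ z in Ioc (0 : ℝ) r, Real.exp (-α2 * z) * (α2 * M) := by
      unfold phiExp
      refine setIntegral_mono_on (hint.mono_set (Ioc_subset_Ioc_right hrc)) ?_
        measurableSet_Ioc ?_
      · apply Continuous.integrableOn_Ioc
        fun_prop
      · intro z hz
        refine mul_le_mul_of_nonneg_left ?_ (Real.exp_pos _).le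
        have hbz : deriv c2 b ≤ deriv c2 (b + z) :=
          hdm ⟨h2, h2'⟩ ⟨by linarith [hz.1], by linarith [hz.2]⟩ (by linarith [hz.1])
        have hI : ∫ x, extD y2 (a + x, b + z, c - z) ∂ν ≤ M := by
          have : ∫ x, extD y2 (a + x, b + z, c - z) ∂ν ≤ ∫ x, M ∂ν := by
            refine integral_mono_of_nonneg (Eventually.of_forall fun x => hext0 _)
              (integrable_const _) ?_
            filter_upwards [aux_ae_nonneg ν hν] with x hx
            unfold extD
            split_ifs with h
            · apply hS
              simp only
              have := aux_delta_anti G2 ν hν g2 hg2c hg2b hg2conc h1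
                (show a ≤ a + x by linarith)
              nlinarith
            · exact hM
          simpa using this
        nlinarith
    refine this.trans ?_
    rw [aux_exp_integral _ _ _ hr0, hk]
    refine mul_le_mul_of_nonneg_right ?_ hM
    have : Real.exp (-α2 * t0) ≤ Real.exp (-α2 * r) := by
      rw [Real.exp_le_exp]; nlinarith
    linarith
  have hpow : ∀ n : ℕ, ∀ q : Dset t0, α2 * DeltaFn g2 ν q.1.1 ≤ deriv c2 q.1.2.1 →
      y2 q ≤ k ^ n * ‖y2‖ := by
    intro n
    induction n with
    | zero =>
      intro q _
      simpa using (le_abs_self _).trans (y2.norm_coe_le_norm q)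
    | succ n ih =>
      have := hstep (k ^ n * ‖y2‖) (by positivity) ih
      intro q hq
      have := this q hq
      rw [pow_succ]
      linarith
  have hzero : ∀ q : Dset t0, α2 * DeltaFn g2 ν q.1.1 ≤ deriv c2 q.1.2.1 → y2 q ≤ 0 := by
    intro q hq
    have ht : Tendsto (fun n : ℕ => k ^ n * ‖y2‖) atTop (𝓝 (0 * ‖y2‖)) :=
      (tendsto_pow_atTop_nhds_zero_of_lt_one hk0 hk1).mul_const _
    rw [zero_mul] at ht
    exact ge_of_tendsto' ht fun n => hpow n q hq
  rintro ⟨a, b, c⟩ hp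
  have hp' := hp
  obtain ⟨h1, ⟨h2, h2'⟩, ⟨h3, h3'⟩, h4⟩ := hp'
  simp only at h1 h2 h2' h3 h3' h4
  have hint := aux_integrable t0 α2 hα2 ν g2 c2 hc2d hc2conv y2 hp
  suffices hG : IsGreatest ((fun r => phiExp α2 g2 c2 ν (extD y2) a b c r) '' Icc 0 c)
        (phiExp α2 g2 c2 ν (extD y2) a b c (rStarExp α2 g2 c2 ν a b c)) by
    refine ⟨hG, ?_⟩
    rw [hfix]
    exact hG.csSup_eq
  have hbdd : BddBelow ({z | 0 ≤ z ∧ α2 * DeltaFn g2 ν a ≤ deriv c2 (b + z)} ∪ {c}) := by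
    refine ⟨0, ?_⟩
    rintro z (hz | hz)
    · exact hz.1
    · rw [mem_singleton_iff.1 hz]; exact h3
  have hne : ({z | 0 ≤ z ∧ α2 * DeltaFn g2 ν a ≤ deriv c2 (b + z)} ∪ {c}).Nonempty :=
    ⟨c, Or.inr rfl⟩
  have hR0 : 0 ≤ rStarExp α2 g2 c2 ν a b c := by
    refine le_csInf hne ?_
    rintro z (hz | hz)
    · exact hz.1
    · rw [mem_singleton_iff.1 hz]; exact h3
  have hRc : rStarExp α2 g2 c2 ν a b c ≤ c := csInf_le hbdd (Or.inr rfl)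
  have hlow : ∀ z, 0 ≤ z → z < rStarExp α2 g2 c2 ν a b c →
      deriv c2 (b + z) < α2 * DeltaFn g2 ν a := by
    intro z hz hzR
    by_contra hcon
    push Not at hcon
    exact absurd (csInf_le hbdd (Or.inl ⟨hz, hcon⟩)) (not_le.2 hzR)
  have hhigh : ∀ z, z ≤ c → rStarExp α2 g2 c2 ν a b c < z →
      α2 * DeltaFn g2 ν a ≤ deriv c2 (b + z) := by
    intro z hz hzR
    obtain ⟨w, hw, hwz⟩ := exists_lt_of_csInf_lt hne hzR
    rcases hw with hw | hw
    · exact hw.2.trans (hdm ⟨by linarith [hw.1], by linarith⟩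
        ⟨by linarith [hw.1], by linarith⟩ (by linarith))
    · rw [mem_singleton_iff.1 hw] at hwz
      linarith
  generalize rStarExp α2 g2 c2 ν a b c = R at *
  refine ⟨⟨R, ⟨hR0, hRc⟩, rfl⟩, ?_⟩
  rintro _ ⟨r, ⟨hr0, hrc⟩, rfl⟩
  simp only
  rcases le_total r R with hrR | hrR
  · unfold phiExp
    rw [aux_split _ hr0 hrR hRc hint]
    refine le_add_of_nonneg_right (setIntegral_nonneg measurableSet_Ioo fun z hz => ?_)
    refine mul_nonneg (Real.exp_pos _).le ?_
    have u1 := hlow z (by linarith [hz.1]) hz.2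
    have u2 : 0 ≤ ∫ x, extD y2 (a + x, b + z, c - z) ∂ν := integral_nonneg fun x => hext0 _
    nlinarith
  · unfold phiExp
    rw [aux_split _ hR0 hrR hrc hint]
    refine add_le_of_nonpos_right (setIntegral_nonpos measurableSet_Ioo fun z hz => ?_)
    refine mul_nonpos_of_nonneg_of_nonpos (Real.exp_pos _).le ?_
    have u1 := hhigh z (by linarith [hz.2]) hz.1
    have u2 : ∫ x, extD y2 (a + x, b + z, c - z) ∂ν = 0 := by
      refine integral_eq_zero_of_ae ?_
      filter_upwards [aux_ae_nonneg ν hν] with x hx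
      refine le_antisymm ?_ (hext0 _)
      simp only [Pi.zero_apply]
      unfold extD
      split_ifs with h
      · apply hzero
        simp only
        have := aux_delta_anti G2 ν hν g2 hg2c hg2b hg2conc h1
          (show a ≤ a + x by linarith)
        nlinarith
      · exact le_rfl
    rw [u2]
    linarith
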